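/- Let A : ℕ → ℚ[X] be an Appell sequence and let n ≥ 4. Define for indices i, j, k the polynomial P_{i,j,k} := ( [n]_k·(A k) · [n−2]_{n−i−k}·(A (n−i−k+2)) − [n−1]_{n−i−k}·(A (n−i−k+1)) · [n−1]_k·(A (k+1)) ) · ( [n]_j·(A j) · [n−2]_{i−j}·(A (i−j+2)) − [n−1]_{i−j}·(A (i−j+1)) · [n−1]_j·(A (j+1)) ). Then the polynomial Ch_n(A) := ∑_{i=0}^{n} ∑_{j=0}^{i} ∑_{k=0}^{n−i} ( (−1)^i · C(n,i) · C(i,j) · C(n−i,k) / ([2n−4]_i · [2n−4]_{n−i}) ) · P_{i,j,k} ∈ ℚ[X] is constant, i.e. it equals Polynomial.C of its value at 0. -/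

import Mathlib

/-- The binomial convolution of the shifted sequences `u (· + a)` and `v (· + b)`. -/
def binomialConv {R : Type*} [CommRing R] (u v : ℕ → R) (a b i : ℕ) : R :=
  ∑ p ∈ Finset.HasAntidiagonal.antidiagonal i, (i.choose p.1 : R) * (u (p.1 + a) * v (p.2 + b))

section binomialConv

variable {R : Type*} [CommRing R]

theorem binomialConv_zero (u v : ℕ → R) (a b : ℕ) :
    binomialConv u v a b 0 = u a * v b := by
  simp [binomialConv]

theorem binomialConv_succ (u v : ℕ → R) (a b i : ℕ) :
    binomialConv u v a b (i + 1) =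
      binomialConv u v (a + 1) b i + binomialConv u v a (b + 1) i := by
  unfold binomialConv
  rw [Finset.sum_antidiagonal_choose_succ_mul (fun x y => u (x + a) * v (y + b)), add_comm]
  congr 1
  · refine Finset.sum_congr rfl fun p hp => ?_
    rw [← Finset.HasAntidiagonal.mem_antidiagonal.mp hp, Nat.choose_symm_add, add_right_comm, add_assoc p.1]
  · refine Finset.sum_congr rfl fun p _ => ?_
    rw [add_right_comm, add_assoc p.2]

theorem binomialConv_comm (u v : ℕ → R) (a b i : ℕ) :
    binomialConv u v a b i = binomialConv v u b a i := by
  unfold binomialConv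
  rw [← Finset.Nat.sum_antidiagonal_swap]
  refine Finset.sum_congr rfl fun p hp => ?_
  rw [← Finset.HasAntidiagonal.mem_antidiagonal.mp hp]
  simp only [Prod.fst_swap, Prod.snd_swap]
  rw [← Nat.choose_symm_add, mul_comm (u _)]

/-- The `sl₂` commutation relation for binomial convolutions: if `D` lowers the index of `u` and
`v` with quadratic weights having the same leading coefficient, then it lowers the indices of
their binomial convolution in the same way. -/
theorem Derivation.map_binomialConv {S : Type*} [CommSemiring S] [Algebra S R]
    (D : Derivation S R R) (u v : ℕ → R) (r s t : R) (N : ℕ)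
    (hu : ∀ a ≤ N, D (u a) = a * (r - t * (a - 1)) * u (a - 1))
    (hv : ∀ b ≤ N, D (v b) = b * (s - t * (b - 1)) * v (b - 1))
    (a b i : ℕ) (ha : a + i ≤ N) (hb : b + i ≤ N) :
    D (binomialConv u v a b i) =
      a * (r - t * (a - 1)) * binomialConv u v (a - 1) b i +
      b * (s - t * (b - 1)) * binomialConv u v a (b - 1) i +
      i * (r + s - t * (2 * (a + b) + i - 1)) * binomialConv u v a b (i - 1) := by
  induction i generalizing a b with
  | zero =>
    simp only [binomialConv_zero, Derivation.leibniz, smul_eq_mul, hu a (by omega),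
      hv b (by omega)]
    push_cast
    ring
  | succ i ih =>
    have hi : (i : R) * (binomialConv u v (a + 1) b (i - 1) +
        binomialConv u v a (b + 1) (i - 1)) = i * binomialConv u v a b i := by
      cases i with
      | zero => simp
      | succ i => rw [binomialConv_succ u v a b i, Nat.add_sub_cancel]
    have hA : (a : R) * binomialConv u v (a - 1) b (i + 1) =
        a * (binomialConv u v a b i + binomialConv u v (a - 1) (b + 1) i) := by
      cases a with
      | zero => simp
      | succ a => rw [binomialConv_succ, Nat.add_sub_cancel]
    have hB : (b : R) * binomialConv u v a (b - 1) (i + 1) =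
        b * (binomialConv u v (a + 1) (b - 1) i + binomialConv u v a b i) := by
      cases b with
      | zero => simp
      | succ b => rw [binomialConv_succ, Nat.add_sub_cancel]
    rw [binomialConv_succ, map_add, ih (a + 1) b (by omega) (by omega),
      ih a (b + 1) (by omega) (by omega)]
    simp only [Nat.add_sub_cancel]
    push_cast
    linear_combination (r + s - t * (2 * (a + b) + i + 1)) * hi -
      (r - t * (a - 1)) * hA - (s - t * (b - 1)) * hB

/-- If `D` acts on `G` as on the powers of a variable, it annihilates the alternating binomial
convolution of `G` with itself. -/
theorem Derivation.map_alternating_binomialConv_eq_zero {S : Type*} [CommSemiring S] [Algebra S R]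
    (D : Derivation S R R) (G : ℕ → R) (n : ℕ) (hG : ∀ i ≤ n, D (G i) = i * G (i - 1)) :
    D (binomialConv (fun i => (-1) ^ i * G i) G 0 0 n) = 0 := by
  rw [D.map_binomialConv (fun i => (-1) ^ i * G i) G (-1) 1 0 n _ _ 0 0 n (by omega) (by omega)]
  · simp
  · intro a ha
    have h1 : D ((-1) ^ a) = 0 := by
      rw [Derivation.leibniz_pow]
      simp
    rw [Derivation.leibniz, h1, hG a ha]
    cases a with
    | zero => simp
    | succ a =>
      simp only [Nat.add_sub_cancel, smul_eq_mul]
      ring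
  · intro b hb
    rw [hG b hb]
    ring

/-- The sequence of lifts of the Hessian `u 0 * u 2 - u 1 ^ 2` (suitably scaled) of a binary form
of degree `n` is lowered like the coefficients of a binary form of degree `2 * n - 4`. -/
theorem Derivation.map_hessian_lift {S : Type*} [CommSemiring S] [Algebra S R]
    (D : Derivation S R R) (u : ℕ → R) (n : R)
    (hu : ∀ a : ℕ, D (u a) = a * (n - (a - 1)) * u (a - 1)) (hn : D n = 0) (i : ℕ) :
    D (n * binomialConv u u 0 2 i - (n - 1) * binomialConv u u 1 1 i) =
      i * (2 * n - 4 - (i - 1)) *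
        (n * binomialConv u u 0 2 (i - 1) - (n - 1) * binomialConv u u 1 1 (i - 1)) := by
  have key := fun a b => D.map_binomialConv u u n n 1 (a + b + i)
    (fun a _ => by rw [hu a, one_mul]) (fun a _ => by rw [hu a, one_mul]) a b i
    (by omega) (by omega)
  simp only [map_sub, Derivation.leibniz, key, hn, Derivation.map_one_eq_zero, smul_eq_mul]
  rw [binomialConv_comm u u 1 (1 - 1)]
  simp only [Nat.sub_self, Nat.add_one_sub_one]
  push_cast
  ring

end binomialConv

open Polynomial in
/-- Scaling by the reciprocal falling factorials of `m` turns the coefficients of a binary form of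
degree `m` into a sequence lowered like the powers of a variable. -/
theorem derivative_inv_descFactorial_smul (H : ℕ → ℚ[X]) (m : ℕ)
    (hH : ∀ i : ℕ, derivative (H i) = (i : ℚ[X]) * ((m : ℚ[X]) - (i - 1)) * H (i - 1))
    (i : ℕ) (hi : i ≤ m) :
    derivative ((m.descFactorial i : ℚ)⁻¹ • H i) =
      (i : ℚ[X]) * ((m.descFactorial (i - 1) : ℚ)⁻¹ • H (i - 1)) := by
  rw [derivative_smul, hH]
  cases i with
  | zero => simp
  | succ i =>
    have h0 : (m.descFactorial i : ℚ) ≠ 0 := by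
      exact_mod_cast (Nat.descFactorial_pos.mpr (by omega)).ne'
    have h1 : (m : ℚ) - i ≠ 0 := by
      rw [sub_ne_zero]
      exact_mod_cast (show m ≠ i by omega)
    have h2 : (m.descFactorial (i + 1) : ℚ)⁻¹ * (m - i) = (m.descFactorial i : ℚ)⁻¹ := by
      rw [Nat.descFactorial_succ, Nat.cast_mul, Nat.cast_sub (by omega)]
      field_simp
    rw [Nat.add_sub_cancel, ← h2]
    simp only [smul_eq_C_mul, map_mul, map_sub, map_natCast]
    push_cast
    ring

open Polynomial in
theorem derivative_descFactorial_mul_appell (A : ℕ → ℚ[X]) (hA0 : derivative (A 0) = 0)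
    (hA : ∀ k : ℕ, derivative (A (k + 1)) = (k + 1) • A k) (n a : ℕ) :
    derivative ((n.descFactorial a : ℚ[X]) * A a) =
      (a : ℚ[X]) * ((n : ℚ[X]) - (a - 1)) * ((n.descFactorial (a - 1) : ℚ[X]) * A (a - 1)) := by
  cases a with
  | zero => simp [hA0]
  | succ a =>
    have h : (n.descFactorial (a + 1) : ℚ[X]) = (n - a) * n.descFactorial a := by
      rw [Nat.descFactorial_succ]
      rcases le_or_gt a n with h | h
      · rw [Nat.cast_mul, Nat.cast_sub h]
      · simp [Nat.descFactorial_of_lt h]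
    rw [derivative_mul, derivative_natCast, hA, h, nsmul_eq_mul, Nat.add_sub_cancel]
    push_cast
    ring

/-- For an Appell sequence `A` and `n ≥ 4`, the degree-4 semi-invariant
expression `Ch_n(A) = ∑_{i=0}^{n} ∑_{j=0}^{i} ∑_{k=0}^{n−i}
((−1)^i C(n,i) C(i,j) C(n−i,k) / ([2n−4]_i [2n−4]_{n−i})) · P_{i,j,k}` is constant,
equal to `C` of its value at `0`. -/
theorem Ch_constant
    (A : ℕ → Polynomial ℚ)
    (hA0 : Polynomial.derivative (A 0) = 0)
    (hA : ∀ k : ℕ, Polynomial.derivative (A (k + 1)) = (k + 1) • A k)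
    (n : ℕ) (hn : 4 ≤ n)
    (P : ℕ → ℕ → ℕ → Polynomial ℚ)
    (hP : ∀ i j k, P i j k =
      ((Nat.descFactorial n k : ℚ) • A k *
          ((Nat.descFactorial (n - 2) (n - i - k) : ℚ) • A (n - i - k + 2)) -
        (Nat.descFactorial (n - 1) (n - i - k) : ℚ) • A (n - i - k + 1) *
          ((Nat.descFactorial (n - 1) k : ℚ) • A (k + 1))) *
      ((Nat.descFactorial n j : ℚ) • A j *
          ((Nat.descFactorial (n - 2) (i - j) : ℚ) • A (i - j + 2)) -
        (Nat.descFactorial (n - 1) (i - j) : ℚ) • A (i - j + 1) *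
          ((Nat.descFactorial (n - 1) j : ℚ) • A (j + 1))))
    (T : Polynomial ℚ)
    (hT : T = ∑ i ∈ Finset.range (n + 1), ∑ j ∈ Finset.range (i + 1),
        ∑ k ∈ Finset.range (n - i + 1),
        (((-1 : ℚ) ^ i * (n.choose i) * (i.choose j) * ((n - i).choose k)) /
            ((Nat.descFactorial (2 * n - 4) i : ℚ) *
              (Nat.descFactorial (2 * n - 4) (n - i) : ℚ))) • P i j k) :
    T = Polynomial.C (T.eval 0) := by
  obtain ⟨N, rfl⟩ := Nat.exists_eq_add_of_le' hn
  set m := 2 * (N + 4) - 4 with hm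
  let u : ℕ → Polynomial ℚ := fun a => ((N + 4).descFactorial a : Polynomial ℚ) * A a
  let H : ℕ → Polynomial ℚ := fun i => ((N + 4 : ℕ) : Polynomial ℚ) * binomialConv u u 0 2 i -
    (((N + 4 : ℕ) : Polynomial ℚ) - 1) * binomialConv u u 1 1 i
  let G : ℕ → Polynomial ℚ := fun i => (m.descFactorial i : ℚ)⁻¹ • H i
  let h : ℕ → ℕ → Polynomial ℚ := fun i j =>
    (Nat.descFactorial (N + 4) j : ℚ) • A j *
      ((Nat.descFactorial (N + 4 - 2) (i - j) : ℚ) • A (i - j + 2)) -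
    (Nat.descFactorial (N + 4 - 1) (i - j) : ℚ) • A (i - j + 1) *
      ((Nat.descFactorial (N + 4 - 1) j : ℚ) • A (j + 1))
  have hmcast : (m : Polynomial ℚ) = 2 * ((N + 4 : ℕ) : Polynomial ℚ) - 4 := by
    rw [hm, show 2 * (N + 4) - 4 = 2 * N + 4 by omega]
    push_cast
    ring
  have hH : ∀ i : ℕ, Polynomial.derivative (H i) =
      (i : Polynomial ℚ) * ((m : Polynomial ℚ) - (i - 1)) * H (i - 1) := fun i => by
    rw [hmcast]
    exact Derivation.map_hessian_lift Polynomial.derivative' u _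
      (derivative_descFactorial_mul_appell A hA0 hA (N + 4)) Polynomial.derivative_natCast i
  have hG : ∀ i ≤ N + 4, Polynomial.derivative (G i) = (i : Polynomial ℚ) * G (i - 1) :=
    fun i hi => derivative_inv_descFactorial_smul H m hH i (by omega)
  have hS : Polynomial.derivative
      (binomialConv (fun i => (-1) ^ i * G i) G 0 0 (N + 4)) = 0 :=
    Derivation.map_alternating_binomialConv_eq_zero Polynomial.derivative' G (N + 4) hG
  set c : ℚ := ((N + 4 : ℚ) ^ 2 * (N + 3))⁻¹ with hc
  have hc0 : c * ((N + 4 : ℚ) ^ 2 * (N + 3)) = 1 := inv_mul_cancel₀ (by positivity)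
  have hsum : ∀ i, ∑ j ∈ Finset.range (i + 1), (i.choose j : Polynomial ℚ) * h i j = c • H i := by
    intro i
    simp only [H, binomialConv, Finset.Nat.sum_antidiagonal_eq_sum_range_succ_mk, Finset.mul_sum,
      ← Finset.sum_sub_distrib, Finset.smul_sum]
    refine Finset.sum_congr rfl fun j _ => ?_
    have e : Polynomial.C c * (((N : Polynomial ℚ) + 4) ^ 2 * (N + 3)) = 1 := by
      have := congrArg Polynomial.C hc0
      simpa only [map_mul, map_add, map_pow, map_natCast, map_ofNat, map_one] using this
    simp only [h, u, Polynomial.smul_eq_C_mul, map_natCast, add_zero,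
      show N + 4 - 2 = N + 2 by omega, show N + 4 - 1 = N + 3 by omega,
      Nat.succ_descFactorial_succ]
    push_cast
    generalize (i.choose j : Polynomial ℚ) = x
    linear_combination (-x * (((N + 4).descFactorial j : Polynomial ℚ) * A j *
      (((N + 2).descFactorial (i - j) : Polynomial ℚ) * A (i - j + 2)) -
      ((N + 3).descFactorial (i - j) : Polynomial ℚ) * A (i - j + 1) *
      (((N + 3).descFactorial j : Polynomial ℚ) * A (j + 1)))) * e
  have hTS : T = c ^ 2 • binomialConv (fun i => (-1) ^ i * G i) G 0 0 (N + 4) := by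
    rw [hT, binomialConv, Finset.Nat.sum_antidiagonal_eq_sum_range_succ_mk, Finset.smul_sum]
    refine Finset.sum_congr rfl fun i _ => ?_
    calc _ = ((-1 : ℚ) ^ i * ((N + 4).choose i) * ((m.descFactorial i : ℚ)⁻¹ *
          (m.descFactorial (N + 4 - i) : ℚ)⁻¹)) •
          ((∑ j ∈ Finset.range (i + 1), (i.choose j : Polynomial ℚ) * h i j) *
          ∑ k ∈ Finset.range (N + 4 - i + 1),
            ((N + 4 - i).choose k : Polynomial ℚ) * h (N + 4 - i) k) := by
          rw [Finset.sum_mul_sum, Finset.smul_sum]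
          refine Finset.sum_congr rfl fun j _ => ?_
          rw [Finset.smul_sum]
          refine Finset.sum_congr rfl fun k _ => ?_
          rw [show P i j k = h (N + 4 - i) k * h i j from hP i j k, div_eq_mul_inv, mul_inv]
          generalize h (N + 4 - i) k = y
          generalize h i j = z
          simp only [Polynomial.smul_eq_C_mul, map_mul, map_natCast]
          ring
      _ = _ := by
          rw [hsum, hsum]
          simp only [G, Polynomial.smul_eq_C_mul, map_mul, map_natCast, map_pow, map_neg, map_one,
            add_zero]
          ring
  have hT' : Polynomial.derivative T = 0 := by
    rw [hTS, Polynomial.derivative_smul, hS, smul_zero]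
  rw [← Polynomial.coeff_zero_eq_eval_zero]
  exact Polynomial.eq_C_of_natDegree_eq_zero
    (Polynomial.derivative_eq_zero.mp hT')
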